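/- Let T, S, d be natural numbers with 1 ≤ d, d − 1 ≤ S and 2S ≤ T. Then ∑_{i=1}^{d−1} C(S, i)·C(T − S, i) ≤ 2^S · C(T, d − 1), where C(a,b) denotes the binomial coefficient a choose b. -/

import Mathlib

open Finset

/-- A probability mass function (probability distribution) on a finite type. -/
def IsPMF {α : Type*} [Fintype α] (Q : α → ℝ) : Prop :=
  (∀ x, 0 ≤ Q x) ∧ ∑ x, Q x = 1

/-- A channel assigns to each input a probability distribution on outputs. -/
def IsChannel {α β : Type*} [Fintype β] (W : α → β → ℝ) : Prop :=
  ∀ x, (∀ y, 0 ≤ W x y) ∧ ∑ y, W x y = 1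

/-- `QW(D) = ∑_x Q(x) · W(D|x)`. -/
noncomputable def outProb {α β : Type*} [Fintype α] (W : α → β → ℝ) (Q : α → ℝ)
    (D : Finset β) : ℝ :=
  ∑ x, Q x * ∑ y ∈ D, W x y

/-- The Hamming weight of a Boolean function: the cardinality of `f⁻¹(1)`. -/
def hammingWeight {m : ℕ} (f : (Fin m → Bool) → Bool) : ℕ :=
  (Finset.univ.filter fun i => f i = true).card

/-- Boolean functions on `m` bits of Hamming weight exactly `S`. -/
def FeqNat (m S : ℕ) : Set ((Fin m → Bool) → Bool) := {f | hammingWeight f = S}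

/-- Boolean functions on `m` bits of Hamming weight at most `S`. -/
def FleNat (m S : ℕ) : Set ((Fin m → Bool) → Bool) := {f | hammingWeight f ≤ S}

/-- Boolean functions on `m` bits of Hamming weight at least `S`. -/
def FgeNat (m S : ℕ) : Set ((Fin m → Bool) → Bool) := {f | S ≤ hammingWeight f}

/-- Boolean functions on `m` bits of Hamming weight at most a real bound `S`. -/
def FleR (m : ℕ) (S : ℝ) : Set ((Fin m → Bool) → Bool) := {f | (hammingWeight f : ℝ) ≤ S}

/-- An `(n, m, ℱ, λ1, λ2)` BFC code: probability distributions `Q i` on `𝒳^n` for each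
message `i ∈ {0,1}^m` and decoding sets `D f ⊆ 𝒴^n` for each `f ∈ ℱ`, such that the
false-negative error is at most `λ1` and the false-positive error is at most `λ2`. -/
def IsBFCCode {𝒳 𝒴 : Type*} [Fintype 𝒳] [Fintype 𝒴] [DecidableEq 𝒴] {n m : ℕ}
    (W : (Fin n → 𝒳) → (Fin n → 𝒴) → ℝ)
    (ℱ : Set ((Fin m → Bool) → Bool))
    (Q : (Fin m → Bool) → (Fin n → 𝒳) → ℝ)
    (D : ((Fin m → Bool) → Bool) → Finset (Fin n → 𝒴))
    (lam1 lam2 : ℝ) : Prop :=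
  (∀ i, IsPMF (Q i)) ∧
  ∀ (i : Fin m → Bool) (f : (Fin m → Bool) → Bool), f ∈ ℱ →
    (f i = true → outProb W (Q i) (D f)ᶜ ≤ lam1) ∧
    (f i = false → outProb W (Q i) (D f) ≤ lam2)

/-- An `(n, M, δ)` transmission code: distinct codewords, pairwise disjoint decoding
sets, and decoding error at most `δ`. -/
def IsTransmissionCode {𝒳 𝒴 : Type*} [Fintype 𝒴] [DecidableEq 𝒴] {n M : ℕ}
    (W : (Fin n → 𝒳) → (Fin n → 𝒴) → ℝ)
    (u : Fin M → (Fin n → 𝒳)) (E : Fin M → Finset (Fin n → 𝒴)) (δ : ℝ) : Prop :=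
  Function.Injective u ∧
  (∀ k l, k ≠ l → Disjoint (E k) (E l)) ∧
  ∀ k, ∑ y ∈ (E k)ᶜ, W (u k) y ≤ δ

/-- A family of channels `(W n)` supports rate `C` if for every `ξ > 0` and
`δ ∈ (0, 1/2)`, for every sufficiently large `n` there is an
`(n, ⌈2^{n(C−ξ)}⌉, δ)` transmission code for `W n`. -/
def SupportsRate {𝒳 𝒴 : Type*} [Fintype 𝒴] [DecidableEq 𝒴]
    (W : ∀ n : ℕ, (Fin n → 𝒳) → (Fin n → 𝒴) → ℝ) (C : ℝ) : Prop :=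
  ∀ ξ : ℝ, 0 < ξ → ∀ δ : ℝ, 0 < δ → δ < 1/2 →
    ∃ n₀ : ℕ, ∀ n ≥ n₀,
      ∃ (u : Fin ⌈(2:ℝ) ^ ((n : ℝ) * (C - ξ))⌉₊ → (Fin n → 𝒳))
        (E : Fin ⌈(2:ℝ) ^ ((n : ℝ) * (C - ξ))⌉₊ → Finset (Fin n → 𝒴)),
        IsTransmissionCode (W n) u E δ

/-- An `(n, N, μ1, μ2)` identification (ID) code. -/
def IsIDCode {𝒳 𝒴 : Type*} [Fintype 𝒳] [Fintype 𝒴] [DecidableEq 𝒴] {n N : ℕ}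
    (W : (Fin n → 𝒳) → (Fin n → 𝒴) → ℝ)
    (Q : Fin N → (Fin n → 𝒳) → ℝ) (D : Fin N → Finset (Fin n → 𝒴))
    (μ1 μ2 : ℝ) : Prop :=
  (∀ j, IsPMF (Q j)) ∧
  (∀ j, outProb W (Q j) (D j)ᶜ ≤ μ1) ∧
  (∀ l j, l ≠ j → outProb W (Q l) (D j) ≤ μ2)

theorem Nat.choose_le_choose_of_le_half {n i k : ℕ} (hik : i ≤ k) (hk : 2 * k ≤ n) :
    n.choose i ≤ n.choose k := by
  induction k, hik using Nat.le_induction with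
  | base => rfl
  | succ k _ ih =>
    exact (ih (by omega)).trans (Nat.choose_le_succ_of_lt_half_left (by omega))

/-- `∑_{i=1}^{d−1} C(S,i)·C(T−S,i) ≤ 2^S · C(T, d−1)`. -/
theorem choose_sum_le (T S d : ℕ) (hd : 1 ≤ d) (hdS : d - 1 ≤ S) (hT : 2 * S ≤ T) :
    ∑ i ∈ Finset.Icc 1 (d - 1), Nat.choose S i * Nat.choose (T - S) i
      ≤ 2 ^ S * Nat.choose T (d - 1) := by
  calc ∑ i ∈ Finset.Icc 1 (d - 1), Nat.choose S i * Nat.choose (T - S) i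
      ≤ ∑ i ∈ Finset.Icc 1 (d - 1), Nat.choose S i * Nat.choose T (d - 1) := by
        refine Finset.sum_le_sum fun i hi => Nat.mul_le_mul_left _ ?_
        exact (Nat.choose_le_choose i (Nat.sub_le T S)).trans
          (Nat.choose_le_choose_of_le_half (Finset.mem_Icc.mp hi).2 (by omega))
    _ = (∑ i ∈ Finset.Icc 1 (d - 1), Nat.choose S i) * Nat.choose T (d - 1) :=
        (Finset.sum_mul _ _ _).symm
    _ ≤ (∑ i ∈ Finset.range (S + 1), Nat.choose S i) * Nat.choose T (d - 1) := by
        refine Nat.mul_le_mul_right _ (Finset.sum_le_sum_of_subset fun i hi => ?_)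
        simp only [Finset.mem_Icc, Finset.mem_range] at hi ⊢
        omega
    _ = 2 ^ S * Nat.choose T (d - 1) := by rw [Nat.sum_range_choose]
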